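/- For every integer t ≥ 0, every t-dominating graph G has a clique or a stable set of cardinality at least |V(G)|/(4t+2). -/

import Mathlib

/-- `u` `t`-dominates `v` in `G`: there are at most `t` vertices different from `u, v`
that are adjacent to `v` and not to `u`. -/
def Dominates {V : Type*} (G : SimpleGraph V) (t : ℕ) (u v : V) : Prop :=
  {w : V | w ≠ u ∧ w ≠ v ∧ G.Adj w v ∧ ¬ G.Adj w u}.ncard ≤ t

/-- `G` is `t`-dominating: for every pair of distinct vertices, one `t`-dominates the other. -/
def IsTDominating {V : Type*} (G : SimpleGraph V) (t : ℕ) : Prop :=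
  ∀ u v : V, u ≠ v → Dominates G t u v ∨ Dominates G t v u

/-- Greedy selection: if every element of `S` has at most `d` predecessors in `S` related to it,
then `S` has a subset of size at least `|S| / (d + 1)` without related pairs. -/
theorem exists_pairwise_not_of_card_pred_le {V α : Type*} [LinearOrder α] (r : V → α)
    (hr : Function.Injective r) (H : V → V → Prop) [DecidableRel H]
    (hH : ∀ a b, H a b → H b a) (d : ℕ) (S : Finset V)
    (hS : ∀ p ∈ S, (S.filter fun q => r q < r p ∧ H q p).card ≤ d) :
    ∃ T ⊆ S, (T : Set V).Pairwise (fun a b => ¬ H a b) ∧ S.card ≤ (d + 1) * T.card := by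
  classical
  induction S using Finset.strongInduction with
  | H S ih =>
    rcases S.eq_empty_or_nonempty with rfl | hne
    · exact ⟨∅, by simp⟩
    obtain ⟨p, hp, hmax⟩ := S.exists_max_image r hne
    set P := S.filter fun q => r q < r p ∧ H q p with hP
    set S' := (S \ P).erase p with hS'
    have hsub : S' ⊆ S := fun x hx => by simp [hS'] at hx; exact hx.2.1
    have hpS' : p ∉ S' := by simp [hS']
    obtain ⟨T, hTS, hT, hcard⟩ := ih S' ⟨hsub, fun h => hpS' (h hp)⟩ fun q hq =>
      (Finset.card_le_card (Finset.filter_subset_filter _ hsub)).trans (hS q (hsub hq))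
    have hpT : p ∉ T := fun h => hpS' (hTS h)
    have key : ∀ b ∈ T, ¬ H b p := by
      intro b hb hbp
      have hb' := hTS hb
      simp only [hS', hP, Finset.mem_erase, Finset.mem_sdiff, Finset.mem_filter] at hb'
      have hlt : r b < r p := lt_of_le_of_ne (hmax b hb'.2.1) (fun h => hb'.1 (hr h))
      exact hb'.2.2 ⟨hb'.2.1, hlt, hbp⟩
    refine ⟨insert p T, Finset.insert_subset hp (hTS.trans hsub), ?_, ?_⟩
    · rw [Finset.coe_insert]
      refine hT.insert fun b hb _ => ⟨fun h => key b hb (hH _ _ h), key b hb⟩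
    · rw [Finset.card_insert_of_notMem hpT]
      have hPd : P.card ≤ d := hS p hp
      have h1 : S.card ≤ (insert p (P ∪ S')).card := by
        refine Finset.card_le_card fun x hx => ?_
        simp only [hS', Finset.mem_insert, Finset.mem_union, Finset.mem_erase, Finset.mem_sdiff]
        tauto
      have h2 := Finset.card_insert_le p (P ∪ S')
      have h3 := Finset.card_union_le P S'
      rw [mul_add]
      lia

open Classical in
/-- In a `t`-dominating graph, a vertex `t`-dominates every vertex of at most its degree. -/
theorem IsTDominating.dominates_of_degree_le {V : Type*} [Fintype V] {t : ℕ} {G : SimpleGraph V}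
    (hG : IsTDominating G t) {u v : V} (huv : u ≠ v) (hdeg : G.degree v ≤ G.degree u) :
    Dominates G t u v := by
  rcases hG u v huv with h | h
  · exact h
  have hset : ∀ a b : V, {w : V | w ≠ a ∧ w ≠ b ∧ G.Adj w b ∧ ¬ G.Adj w a} =
      ((G.neighborFinset b \ G.neighborFinset a).erase a : Finset V) := by
    intro a b
    ext w
    simp only [Set.mem_ofPred_eq, Finset.mem_coe, Finset.mem_erase, Finset.mem_sdiff,
      SimpleGraph.mem_neighborFinset, G.adj_comm w]
    refine ⟨fun h => ⟨h.1, h.2.2⟩, fun h => ⟨h.1, ?_, h.2⟩⟩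
    rintro rfl
    exact G.loopless.irrefl _ h.2.1
  unfold Dominates at h ⊢
  rw [hset, Set.ncard_coe_finset] at h ⊢
  refine le_trans ?_ h
  have h1 := Finset.card_sdiff_add_card_inter (G.neighborFinset v) (G.neighborFinset u)
  have h2 := Finset.card_sdiff_add_card_inter (G.neighborFinset u) (G.neighborFinset v)
  rw [Finset.inter_comm] at h2
  rw [G.card_neighborFinset_eq_degree] at h1 h2
  by_cases hadj : G.Adj u v
  · rw [Finset.card_erase_of_mem (by simp [hadj.symm]), Finset.card_erase_of_mem (by simp [hadj])]
    lia
  · rw [Finset.erase_eq_of_notMem (by simp [G.adj_comm v, hadj]),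
      Finset.erase_eq_of_notMem (by simp [hadj])]
    lia

open Classical in
/-- If every `x ∈ X` `t`-dominates `p`, which `t`-dominates every `y ∈ Y`, where `X` consists of
nonneighbours and `Y` of neighbours of `p`, then `X` and `Y` cannot both have `2 * t + 1`
elements. -/
theorem not_both_card_eq_of_dominates {V : Type*} [Finite V] {t : ℕ} {G : SimpleGraph V} {p : V}
    {X Y : Finset V} (hX : ∀ x ∈ X, x ≠ p ∧ ¬ G.Adj x p ∧ Dominates G t x p)
    (hY : ∀ y ∈ Y, G.Adj y p ∧ Dominates G t p y)
    (hXc : X.card = 2 * t + 1) (hYc : Y.card = 2 * t + 1) : False := by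
  have hx : ∀ x ∈ X, (Y.filter fun y => ¬ G.Adj x y).card ≤ t := by
    intro x hx
    obtain ⟨-, hxp, hdom⟩ := hX x hx
    rw [← Set.ncard_coe_finset]
    refine (Set.ncard_le_ncard ?_ (Set.toFinite _)).trans hdom
    intro y hy
    obtain ⟨hyY, hxy⟩ := Finset.mem_filter.1 hy
    obtain ⟨hyp, -⟩ := hY y hyY
    exact ⟨fun h => hxp (h ▸ hyp), hyp.ne, hyp, fun h => hxy h.symm⟩
  have hy : ∀ y ∈ Y, (X.filter fun x => G.Adj x y).card ≤ t := by
    intro y hy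
    obtain ⟨-, hdom⟩ := hY y hy
    rw [← Set.ncard_coe_finset]
    refine (Set.ncard_le_ncard ?_ (Set.toFinite _)).trans hdom
    intro x hx
    obtain ⟨hxX, hxy⟩ := Finset.mem_filter.1 hx
    obtain ⟨hne, hxp, -⟩ := hX x hxX
    exact ⟨hne, hxy.ne, hxy, hxp⟩
  have h1 := Finset.sum_le_card_nsmul X _ t hx
  have h2 := Finset.sum_le_card_nsmul Y _ t hy
  have h3 := Finset.sum_card_bipartiteAbove_eq_sum_card_bipartiteBelow
    (s := X) (t := Y) (fun x y => G.Adj x y)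
  have h4 : ∑ x ∈ X, (Y.filter fun y => G.Adj x y).card +
      ∑ x ∈ X, (Y.filter fun y => ¬ G.Adj x y).card = X.card * Y.card := by
    rw [← Finset.sum_add_distrib]
    simp [Finset.card_filter_add_card_filter_not]
  simp only [Finset.bipartiteAbove, Finset.bipartiteBelow] at h3
  rw [hXc, smul_eq_mul] at h1
  rw [hYc, smul_eq_mul] at h2
  rw [hXc, hYc] at h4
  nlinarith

theorem statement_18 {V : Type*} [Fintype V] (t : ℕ) (G : SimpleGraph V)
    (hG : IsTDominating G t) :
    ∃ S : Set V, (S.Pairwise G.Adj ∨ S.Pairwise (fun a b => ¬ G.Adj a b)) ∧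
      Fintype.card V ≤ (4 * t + 2) * S.ncard := by
  classical
  let r : V → ℕᵒᵈ ×ₗ Fin (Fintype.card V) := fun v =>
    toLex (OrderDual.toDual (G.degree v), Fintype.equivFin V v)
  have hr : Function.Injective r := fun a b h => by
    have h' : (Fintype.equivFin V) a = (Fintype.equivFin V) b :=
      congrArg (fun z => (ofLex z).2) h
    exact (Fintype.equivFin V).injective h'
  have hdom : ∀ u v, r u < r v → Dominates G t u v := by
    intro u v h
    refine hG.dominates_of_degree_le (fun e => h.ne (congrArg r e)) ?_
    rcases Prod.Lex.lt_iff.1 h with h | h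
    · exact (OrderDual.toDual_lt_toDual.1 h).le
    · exact (OrderDual.toDual_inj.1 h.1).ge
  let L : V → Finset V := fun p => Finset.univ.filter fun q => r q < r p ∧ ¬ G.Adj q p
  let R : V → Finset V := fun p => Finset.univ.filter fun q => r p < r q ∧ G.Adj q p
  let A : Finset V := Finset.univ.filter fun p => (L p).card ≤ 2 * t
  let B : Finset V := Finset.univ.filter fun p => (R p).card ≤ 2 * t
  have hAB : Fintype.card V ≤ A.card + B.card := by
    refine le_trans (Finset.card_le_card fun p _ => ?_) (Finset.card_union_le A B)
    by_contra hp
    simp only [A, B, Finset.mem_union, Finset.mem_filter, Finset.mem_univ, true_and, not_or,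
      not_le] at hp
    obtain ⟨X, hXs, hX⟩ := Finset.exists_subset_card_eq (Nat.succ_le_of_lt hp.1)
    obtain ⟨Y, hYs, hY⟩ := Finset.exists_subset_card_eq (Nat.succ_le_of_lt hp.2)
    refine not_both_card_eq_of_dominates (G := G) (p := p) (fun x hx => ?_) (fun y hy => ?_) hX hY
    · obtain ⟨-, h1, h2⟩ := Finset.mem_filter.1 (hXs hx)
      exact ⟨fun e => h1.ne (congrArg r e), h2, hdom _ _ h1⟩
    · obtain ⟨-, h1, h2⟩ := Finset.mem_filter.1 (hYs hy)
      exact ⟨h2, hdom _ _ h1⟩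
  obtain ⟨T, -, hT, hTc⟩ := exists_pairwise_not_of_card_pred_le r hr (fun a b => ¬ G.Adj a b)
    (fun a b h h' => h h'.symm) (2 * t) A fun p hp =>
      (Finset.card_le_card fun _ hq => Finset.mem_filter.2
        ⟨Finset.mem_univ _, (Finset.mem_filter.1 hq).2⟩).trans (Finset.mem_filter.1 hp).2
  obtain ⟨U, -, hU, hUc⟩ := exists_pairwise_not_of_card_pred_le (fun v => OrderDual.toDual (r v))
    (fun a b h => hr h) G.Adj (fun a b h => h.symm) (2 * t) B fun p hp =>
      (Finset.card_le_card fun _ hq => Finset.mem_filter.2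
        ⟨Finset.mem_univ _, (Finset.mem_filter.1 hq).2⟩).trans (Finset.mem_filter.1 hp).2
  rcases le_total A.card B.card with h | h
  · refine ⟨U, Or.inr hU, ?_⟩
    rw [Set.ncard_coe_finset]
    nlinarith
  · refine ⟨T, Or.inl fun a ha b hb hab => not_not.1 (hT ha hb hab), ?_⟩
    rw [Set.ncard_coe_finset]
    nlinarith
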